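/- Consider the 3-player game arena G with players P={0,1,2}, vertices V={v_0,v_1,v_2} with V_p={v_p}, initial vertex v_0, and edges between every pair of distinct vertices, and the objective profile α'=(O_p)_{p∈P} with O_p=Büchi({v_p}). Then T_{G,α',Pos}=Pos: every profile of positional strategies belongs to the characterization of common knowledge of rationality for G, α' and Pos. -/

import Mathlib

open scoped Classical

namespace EpistemicRV

/-- Boolean formulas over variables of type `α`. -/
inductive BForm (α : Type) : Type where
  | tru : BForm α
  | fls : BForm α
  | var : α → BForm α
  | not : BForm α → BForm α
  | and : BForm α → BForm α → BForm α
  | or : BForm α → BForm α → BForm α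

/-- Evaluation of a Boolean formula under a truth assignment. -/
def BForm.eval {α : Type} (θ : α → Prop) : BForm α → Prop
  | .tru => True
  | .fls => False
  | .var a => θ a
  | .not f => ¬ (f.eval θ)
  | .and f g => f.eval θ ∧ g.eval θ
  | .or f g => f.eval θ ∨ g.eval θ

/-- Renaming of variables of a Boolean formula. -/
def BForm.map {α β : Type} (h : α → β) : BForm α → BForm β
  | .tru => .tru
  | .fls => .fls
  | .var a => .var (h a)
  | .not f => .not (f.map h)
  | .and f g => .and (f.map h) (g.map h)
  | .or f g => .or (f.map h) (g.map h)

/-- A game arena: each vertex has an owner, there is an initial vertex and an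
edge relation.  (Totality of the edge relation is stated as a separate
hypothesis where needed.) -/
structure Arena (P V : Type) : Type where
  owner : V → P
  v0 : V
  edge : V → V → Prop

/-- A strategy: given the (reversed) past history and the current vertex,
it yields the next vertex.  A history `h v` (ending in the current vertex `v`)
is represented by the pair of the reversed list `h` and `v`. -/
abbrev Strat (V : Type) : Type := List V → V → V

/-- A strategy profile assigns a strategy to every player. -/
abbrev Profile (P V : Type) : Type := P → Strat V

variable {P V : Type}

/-- A strategy respecting the edge relation. -/
def ValidStrat (A : Arena P V) (s : Strat V) : Prop := ∀ h v, A.edge v (s h v)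

/-- A positional strategy only depends on the current vertex. -/
def PositionalStrat (s : Strat V) : Prop := ∀ h h' v, s h v = s h' v

/-- The class Σ of all strategies. -/
def allClass (A : Arena P V) : Set (Strat V) := {s | ValidStrat A s}

/-- The class Pos of positional strategies. -/
def posClass (A : Arena P V) : Set (Strat V) := {s | ValidStrat A s ∧ PositionalStrat s}

/-- Strategy profiles ranging over the class `C` of strategies. -/
def profiles (A : Arena P V) (C : Set (Strat V)) : Set (Profile P V) :=
  {s | ∀ p, s p ∈ C}

/-- `upd s p t` is the profile `s[p ↦ t]`. -/
noncomputable def upd (s : Profile P V) (p : P) (t : Strat V) : Profile P V :=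
  fun q => if q = p then t else s q

/-- The reversed history of length `n+1` generated by the profile `s`. -/
def histOf (A : Arena P V) (s : Profile P V) : ℕ → List V
  | 0 => [A.v0]
  | n + 1 =>
    match histOf A s n with
    | [] => [A.v0]
    | v :: h => s (A.owner v) h v :: v :: h

/-- The outcome play `out(s)` of the profile `s`. -/
def Out (A : Arena P V) (s : Profile P V) : ℕ → V :=
  fun n => (histOf A s n).getD 0 A.v0

/-- The set of plays of an arena. -/
def plays (A : Arena P V) : Set (ℕ → V) :=
  {ρ | ρ 0 = A.v0 ∧ ∀ i, A.edge (ρ i) (ρ (i + 1))}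

/-- `Inf(ρ)`: the set of vertices occurring infinitely often in `ρ`. -/
def InfSet (ρ : ℕ → V) : Set V := {v | ∀ i, ∃ j, i ≤ j ∧ ρ j = v}

/-- The Büchi objective for the set `U` of vertices. -/
def Buchi (U : Set V) : Set (ℕ → V) := {ρ | (InfSet ρ ∩ U).Nonempty}

/-- The Muller objective for a Boolean formula over the vertices. -/
def Muller (φ : BForm V) : Set (ℕ → V) := {ρ | φ.eval (fun v => v ∈ InfSet ρ)}

/-- `s` is a Nash equilibrium for the objective profile `O` and the class `C`. -/
def NashEq (A : Arena P V) (O : P → Set (ℕ → V)) (C : Set (Strat V))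
    (s : Profile P V) : Prop :=
  ∀ p, ∀ t ∈ C, Out A (upd s p t) ∈ O p → Out A s ∈ O p

/-- `t` is a winning strategy of player `p` for objective `Op` over class `C`. -/
def WinningStrat (A : Arena P V) (Op : Set (ℕ → V)) (C : Set (Strat V))
    (p : P) (t : Strat V) : Prop :=
  t ∈ C ∧ ∀ s ∈ profiles A C, Out A (upd s p t) ∈ Op

/-- Knowledge operator of a single accessibility relation. -/
def Kop {W : Type} (R : W → W → Prop) (E : Set W) : Set W :=
  {w | ∀ w', R w w' → w' ∈ E}

/-- Mutual knowledge operator. -/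
def MKop {W : Type} (R : P → W → W → Prop) (E : Set W) : Set W :=
  ⋂ p, Kop (R p) E

/-- Common knowledge operator: `CK(E) = ⋂_{i ≥ 1} MK^i(E)`. -/
def CKop {W : Type} (R : P → W → W → Prop) (E : Set W) : Set W :=
  ⋂ i ∈ Set.Ici (1 : ℕ), (MKop R)^[i] E

/-- Player `p` is rational in world `w` (for arena `A`, objective profile `O`,
class `C`, accessibility relations `R` and strategy assignment `σ`). -/
def RationalIn (A : Arena P V) (O : P → Set (ℕ → V)) (C : Set (Strat V))
    {W : Type} (R : P → W → W → Prop) (σ : W → Profile P V) (p : P) (w : W) : Prop :=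
  ¬ ∃ t ∈ C,
      (∀ w', R p w w' → (Out A (σ w') ∈ O p → Out A (upd (σ w') p t) ∈ O p)) ∧
      (∃ w', R p w w' ∧ Out A (σ w') ∉ O p ∧ Out A (upd (σ w') p t) ∈ O p)

/-- The set of worlds in which every player is rational. -/
def RAT (A : Arena P V) (O : P → Set (ℕ → V)) (C : Set (Strat V))
    {W : Type} (R : P → W → W → Prop) (σ : W → Profile P V) : Set W :=
  {w | ∀ p, RationalIn A O C R σ p w}

/-- An epistemic model for the arena `A` and the class `C` of strategies. -/
structure EModel {P V : Type} (A : Arena P V) (C : Set (Strat V)) : Type 1 where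
  W : Type
  finW : Finite W
  R : P → W → W → Prop
  equivR : ∀ p, Equivalence (R p)
  σ : W → Profile P V
  memC : ∀ w, σ w ∈ profiles A C
  consistent : ∀ p w w', R p w w' → σ w p = σ w' p

/-- The characterization `T_{G,α,S}` of common knowledge of rationality. -/
def Tchar (A : Arena P V) (O : P → Set (ℕ → V)) (C : Set (Strat V)) :
    Set (Profile P V) :=
  {s | ∃ M : EModel A C, ∃ w : M.W,
        w ∈ CKop M.R (RAT A O C M.R M.σ) ∧ M.σ w = s}

end EpistemicRV

namespace EpistemicRV

/-- The 3-player arena of the running example: players and vertices are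
`Fin 3`, `V_p = {v_p}`, the initial vertex is `v_0`, and there is an edge
between every pair of distinct vertices. -/
def exArena : Arena (Fin 3) (Fin 3) where
  owner := id
  v0 := 0
  edge := fun i j => i ≠ j

/-- The successor map on vertices induced by a profile, ignoring the past. -/
def succVertex (A : Arena P V) (s : Profile P V) (v : V) : V := s (A.owner v) [] v

theorem exists_histOf_eq_cons (A : Arena P V) (s : Profile P V) (n : ℕ) :
    ∃ h, histOf A s n = Out A s n :: h := by
  have key : ∃ v h, histOf A s n = v :: h := by
    cases n with
    | zero => exact ⟨_, _, rfl⟩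
    | succ n =>
      rw [histOf]
      split <;> exact ⟨_, _, rfl⟩
  obtain ⟨v, h, hv⟩ := key
  exact ⟨h, by simp [Out, hv]⟩

theorem Out_eq_iterate {A : Arena P V} {s : Profile P V}
    (hs : ∀ p, PositionalStrat (s p)) (n : ℕ) : Out A s n = (succVertex A s)^[n] A.v0 := by
  induction n with
  | zero => rfl
  | succ n ih =>
    obtain ⟨h, hh⟩ := exists_histOf_eq_cons A s n
    rw [Function.iterate_succ_apply', ← ih, succVertex, hs _ [] h]
    conv_lhs => rw [Out, histOf, hh]
    rfl

theorem upd_mem_profiles {A : Arena P V} {C : Set (Strat V)} {s : Profile P V}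
    (hs : s ∈ profiles A C) (p : P) {t : Strat V} (ht : t ∈ C) :
    upd s p t ∈ profiles A C := by
  intro q
  unfold upd
  split
  · exact ht
  · exact hs q

theorem mem_InfSet_iff_of_periodic {ρ : ℕ → V} {m k : ℕ} (hk : 0 < k)
    (h : ∀ n, ρ (n + m + k) = ρ (n + m)) (v : V) :
    v ∈ InfSet ρ ↔ ∃ i < k, ρ (i + m) = v := by
  have hper : Function.Periodic (fun n => ρ (n + m)) k := fun n => by
    simpa only [Nat.add_right_comm] using h n
  constructor
  · intro hv
    obtain ⟨j, hj, rfl⟩ := hv m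
    refine ⟨(j - m) % k, Nat.mod_lt _ hk, ?_⟩
    simpa [Nat.sub_add_cancel hj] using hper.map_mod_nat (j - m)
  · rintro ⟨i, -, rfl⟩ j
    refine ⟨i + j * k + m, by nlinarith, ?_⟩
    simpa using hper.nat_mul j i

theorem mem_Buchi_singleton {v : V} {ρ : ℕ → V} : ρ ∈ Buchi {v} ↔ v ∈ InfSet ρ := by
  simp [Buchi]

theorem CKop_univ {W : Type} (R : P → W → W → Prop) : CKop R Set.univ = Set.univ := by
  have h : MKop R Set.univ = Set.univ := by simp [MKop, Kop]
  simp [CKop, Function.iterate_fixed h]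

theorem RAT_eq_univ_of_nashEq {A : Arena P V} {O : P → Set (ℕ → V)} {C : Set (Strat V)}
    {W : Type} {R : P → W → W → Prop} {σ : W → Profile P V}
    (h : ∀ w, NashEq A O C (σ w)) : RAT A O C R σ = Set.univ := by
  refine Set.eq_univ_of_forall fun w p => ?_
  rintro ⟨t, ht, -, w', -, hlose, hwin⟩
  exact hlose (h w' p t ht hwin)

theorem NashEq.mem_Tchar {A : Arena P V} {O : P → Set (ℕ → V)} {C : Set (Strat V)}
    {s : Profile P V} (h : NashEq A O C s) (hs : s ∈ profiles A C) : s ∈ Tchar A O C := by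
  let M : EModel A C :=
    { W := Unit
      finW := inferInstance
      R := fun _ => Eq
      equivR := fun _ => eq_equivalence
      σ := fun _ => s
      memC := fun _ => hs
      consistent := fun _ _ _ _ => rfl }
  refine ⟨M, (), ?_, rfl⟩
  rw [RAT_eq_univ_of_nashEq (fun _ => h), CKop_univ]
  trivial

theorem Tchar_subset_profiles (A : Arena P V) (O : P → Set (ℕ → V)) (C : Set (Strat V)) :
    Tchar A O C ⊆ profiles A C := by
  rintro _ ⟨M, w, -, rfl⟩
  exact M.memC w

theorem iterate_eight_eq_iterate_two (g : Fin 3 → Fin 3) (hg : ∀ v, g v ≠ v) (v : Fin 3) :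
    g^[8] v = g^[2] v := by
  revert g v
  decide

theorem exists_iterate_eq_of_update (g : Fin 3 → Fin 3) (hg : ∀ v, g v ≠ v) (p x : Fin 3)
    (hx : x ≠ p) (h : ∃ i < 6, (Function.update g p x)^[i + 2] 0 = p) :
    ∃ i < 6, g^[i + 2] 0 = p := by
  revert g p x
  decide

theorem exArena_Out_mem_Buchi_iff {s : Profile (Fin 3) (Fin 3)}
    (hs : s ∈ profiles exArena (posClass exArena)) (p : Fin 3) :
    Out exArena s ∈ Buchi {p} ↔ ∃ i < 6, (succVertex exArena s)^[i + 2] 0 = p := by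
  have hout : Out exArena s = fun n => (succVertex exArena s)^[n] 0 :=
    funext (Out_eq_iterate fun p => (hs p).2)
  have hg : ∀ v, succVertex exArena s v ≠ v := fun v => ((hs v).1 [] v).symm
  rw [mem_Buchi_singleton, hout, mem_InfSet_iff_of_periodic (m := 2) (k := 6) (by norm_num)]
  intro n
  rw [add_assoc, Function.iterate_add_apply, iterate_eight_eq_iterate_two _ hg,
    ← Function.iterate_add_apply]

theorem exArena_nashEq {s : Profile (Fin 3) (Fin 3)}
    (hs : s ∈ profiles exArena (posClass exArena)) :
    NashEq exArena (fun p => Buchi {p}) (posClass exArena) s := by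
  intro p t ht hwin
  have hupd : succVertex exArena (upd s p t) = Function.update (succVertex exArena s) p (t [] p) := by
    funext v
    by_cases hv : v = p
    · subst hv
      simp [succVertex, upd, exArena]
    · simp [succVertex, upd, exArena, hv]
  rw [exArena_Out_mem_Buchi_iff (upd_mem_profiles hs p ht), hupd] at hwin
  rw [exArena_Out_mem_Buchi_iff hs]
  exact exists_iterate_eq_of_update _ (fun v => ((hs v).1 [] v).symm) p _
    (ht.1 [] p).symm hwin

/-- for the objective profile `α' = (Büchi({v_p}))_{p∈P}` in the
3-player example arena, `T_{G,α',Pos} = Pos`. -/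
theorem example_Tchar_eq_pos :
    Tchar exArena (fun p => Buchi ({p} : Set (Fin 3))) (posClass exArena) =
      profiles exArena (posClass exArena) := by
  exact (Tchar_subset_profiles _ _ _).antisymm fun _ hs => (exArena_nashEq hs).mem_Tchar hs

end EpistemicRV
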